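/- Let f : ℝ³ → ℝ be smooth with compact support and let ψ(z) = ‖z‖. Then for every v ∈ ℝ³ and every i ∈ {1,2,3}, ∫_{ℝ³} Σ_{j=1}^{3} A_{ij}(v−w) ∂_j f(w) dw = ∂_i (Δ(ψ⋆f))(v), where A(z) = ‖z‖⁻¹ (I − z⊗z/‖z‖²) for z ≠ 0; that is, the convolution ∫ A(v−w) ∇f(w) dw equals the gradient of the Laplacian of the Rosenbluth potential ψ⋆f at v. -/

import Mathlib

open Real MeasureTheory
noncomputable section

/-- Partial derivative in the `i`-th coordinate direction. -/
def pd (i : Fin 3) (f : EuclideanSpace ℝ (Fin 3) → ℝ) :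
    EuclideanSpace ℝ (Fin 3) → ℝ :=
  fun v => fderiv ℝ f v (EuclideanSpace.single i 1)

/-- The Laplacian `Δf = Σ_j ∂_j² f`. -/
def lap (f : EuclideanSpace ℝ (Fin 3) → ℝ) : EuclideanSpace ℝ (Fin 3) → ℝ :=
  fun v => ∑ j, pd j (pd j f) v

/-- The Landau collision kernel matrix for Coulombian interactions:
`A(z) = ‖z‖⁻¹ (I − z⊗z/‖z‖²)` (with the Lean convention `0⁻¹ = 0` at `z = 0`). -/
def landauKernel (z : EuclideanSpace ℝ (Fin 3)) : Fin 3 → Fin 3 → ℝ :=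
  fun i j => ‖z‖⁻¹ * ((if i = j then (1 : ℝ) else 0) - z i * z j / ‖z‖ ^ 2)

lemma contDiff_pd (i : Fin 3) {f : EuclideanSpace ℝ (Fin 3) → ℝ}
    (hf : ContDiff ℝ (⊤ : ℕ∞) f) : ContDiff ℝ (⊤ : ℕ∞) (pd i f) := by
  unfold pd
  exact (hf.fderiv_right (m := ((⊤ : ℕ∞) : WithTop ℕ∞)) (by simp)).clm_apply contDiff_const

lemma hasCompactSupport_pd (i : Fin 3) {f : EuclideanSpace ℝ (Fin 3) → ℝ}
    (hf : HasCompactSupport f) : HasCompactSupport (pd i f) :=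
  hf.fderiv_apply ℝ _

lemma pd_conv {h : EuclideanSpace ℝ (Fin 3) → ℝ}
    (hf : ContDiff ℝ (⊤ : ℕ∞) h) (hs : HasCompactSupport h) (x : EuclideanSpace ℝ (Fin 3)) :
    DifferentiableAt ℝ (fun x => ∫ u, ‖u‖ * h (x - u)) x ∧ ∀ i,
    pd i (fun x => ∫ u, ‖u‖ * h (x - u)) x = ∫ u, ‖u‖ * pd i h (x - u) := by
  have hl : LocallyIntegrable (fun u : EuclideanSpace ℝ (Fin 3) => ‖u‖) volume :=
    continuous_norm.locallyIntegrable
  have h1 : ContDiff ℝ 1 h := hf.of_le (by exact_mod_cast le_top)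
  have := hs.hasFDerivAt_convolution_right (ContinuousLinearMap.mul ℝ ℝ) hl h1 x
  have e : (fun x => ∫ u, ‖u‖ * h (x - u)) =
    convolution (fun u : EuclideanSpace ℝ (Fin 3) => ‖u‖) h (ContinuousLinearMap.mul ℝ ℝ) volume := by
    ext x; simp [convolution_def]
  rw [e]
  refine ⟨this.differentiableAt, fun i => ?_⟩
  unfold pd
  rw [this.fderiv, convolution_precompR_apply _ hl (hs.fderiv ℝ) (h1.continuous_fderiv one_ne_zero)]
  simp [convolution_def]

lemma grad_lap_conv {f : EuclideanSpace ℝ (Fin 3) → ℝ}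
    (hf : ContDiff ℝ (⊤ : ℕ∞) f) (hs : HasCompactSupport f) (v : EuclideanSpace ℝ (Fin 3))
    (i : Fin 3) :
    pd i (lap (fun x => ∫ u, ‖u‖ * f (x - u))) v
      = ∑ j, ∫ u, ‖u‖ * pd i (pd j (pd j f)) (v - u) := by
  have e : lap (fun x => ∫ u, ‖u‖ * f (x - u)) =
      fun x => ∑ j, ∫ u, ‖u‖ * pd j (pd j f) (x - u) := by
    ext x
    unfold lap
    refine Finset.sum_congr rfl fun j _ => ?_
    have : pd j (fun x => ∫ u, ‖u‖ * f (x - u)) = fun x => ∫ u, ‖u‖ * pd j f (x - u) := by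
      ext y; exact (pd_conv hf hs y).2 j
    rw [this]
    exact (pd_conv (contDiff_pd j hf) (hasCompactSupport_pd j hs) x).2 j
  rw [e]
  have key := fun j => pd_conv (contDiff_pd j (contDiff_pd j hf))
    (hasCompactSupport_pd j (hasCompactSupport_pd j hs)) v
  rw [pd, fderiv_fun_sum (fun j _ => (key j).1), ContinuousLinearMap.sum_apply]
  exact Finset.sum_congr rfl fun j _ => (key j).2 i

/-- regularised norm -/
def rn (e : ℝ) (u : EuclideanSpace ℝ (Fin 3)) : ℝ := √(‖u‖ ^ 2 + e ^ 2)

lemma rn_pos {e : ℝ} (he : 0 < e) (u) : 0 < rn e u := by unfold rn; positivity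

lemma contDiff_rn {e : ℝ} (he : 0 < e) : ContDiff ℝ (⊤ : ℕ∞) (rn e) := by
  unfold rn
  refine ContDiff.sqrt ((contDiff_norm_sq ℝ).add contDiff_const) fun u => ?_
  positivity

lemma hasFDerivAt_rn {e : ℝ} (he : 0 < e) (u : EuclideanSpace ℝ (Fin 3)) :
    HasFDerivAt (rn e) ((rn e u)⁻¹ • innerSL ℝ u) u := by
  have h := ((hasStrictFDerivAt_norm_sq u).hasFDerivAt.add_const (e ^ 2)).sqrt
    (by positivity : ‖u‖ ^ 2 + e ^ 2 ≠ 0)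
  refine h.congr_fderiv ?_
  ext w
  simp [rn]
  ring

lemma pd_rn {e : ℝ} (he : 0 < e) (i : Fin 3) :
    pd i (rn e) = fun u => (rn e u)⁻¹ * u i := by
  ext u
  rw [pd, (hasFDerivAt_rn he u).fderiv]
  simp [EuclideanSpace.inner_single_right]

lemma pd_pd_rn {e : ℝ} (he : 0 < e) (i j : Fin 3) :
    pd j (pd i (rn e)) = fun u => (rn e u)⁻¹ *
      ((if i = j then (1 : ℝ) else 0) - u i * u j / rn e u ^ 2) := by
  ext u
  rw [pd_rn he, pd]
  have h1 := (hasDerivAt_inv (rn_pos he u).ne').comp_hasFDerivAt u (hasFDerivAt_rn he u)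
  have h2 : HasFDerivAt (fun u : EuclideanSpace ℝ (Fin 3) => u i)
    (EuclideanSpace.proj i : EuclideanSpace ℝ (Fin 3) →L[ℝ] ℝ) u :=
    (EuclideanSpace.proj i : EuclideanSpace ℝ (Fin 3) →L[ℝ] ℝ).hasFDerivAt
  have h3 := h1.mul h2
  have := (rn_pos he u).ne'
  have h4 : fderiv ℝ (fun u => (rn e u)⁻¹ * u i) u = _ := h3.fderiv
  rw [h4]
  simp [EuclideanSpace.inner_single_right, Pi.single_apply]
  split_ifs <;> field_simp <;> ring

lemma integrable_cc {a b : EuclideanSpace ℝ (Fin 3) → ℝ} (ha : Continuous a) (hb : Continuous b)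
    (hs : HasCompactSupport b) : Integrable (fun u => a u * b u) :=
  (ha.mul hb).integrable_of_hasCompactSupport hs.mul_left

lemma ibp {a b : EuclideanSpace ℝ (Fin 3) → ℝ} (ha : ContDiff ℝ (⊤ : ℕ∞) a)
    (hb : ContDiff ℝ (⊤ : ℕ∞) b) (hs : HasCompactSupport b) (i : Fin 3) :
    ∫ u, a u * pd i b u = - ∫ u, pd i a u * b u := by
  refine integral_mul_fderiv_eq_neg_fderiv_mul_of_integrable ?_ ?_ ?_ ?_ ?_
  · exact integrable_cc (contDiff_pd i ha).continuous hb.continuous hs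
  · exact integrable_cc ha.continuous (contDiff_pd i hb).continuous (hasCompactSupport_pd i hs)
  · exact integrable_cc ha.continuous hb.continuous hs
  · exact fun x _ => ha.differentiable (by simp) x
  · exact fun x _ => hb.differentiable (by simp) x

lemma ibp_rn {e : ℝ} (he : 0 < e) {b : EuclideanSpace ℝ (Fin 3) → ℝ}
    (hb : ContDiff ℝ (⊤ : ℕ∞) b) (hs : HasCompactSupport b) (i j : Fin 3) :
    ∫ u, rn e u * pd i (pd j b) u = ∫ u, ((rn e u)⁻¹ *
      ((if i = j then (1 : ℝ) else 0) - u i * u j / rn e u ^ 2)) * b u := by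
  rw [ibp (contDiff_rn he) (contDiff_pd j hb) (hasCompactSupport_pd j hs),
    ibp (contDiff_pd i (contDiff_rn he)) hb hs, neg_neg, pd_pd_rn he]

lemma ker_bound {r : ℝ} (u : EuclideanSpace ℝ (Fin 3)) (hu : u ≠ 0) (hr : ‖u‖ ≤ r) (i j : Fin 3) :
    |r⁻¹ * ((if i = j then (1 : ℝ) else 0) - u i * u j / r ^ 2)| ≤ 2 * ‖u‖⁻¹ := by
  have hu' : 0 < ‖u‖ := norm_pos_iff.mpr hu
  have hr0 : 0 < r := hu'.trans_le hr
  have hi : |u i| ≤ r := (PiLp.norm_apply_le u i).trans hr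
  have hj : |u j| ≤ r := (PiLp.norm_apply_le u j).trans hr
  have h1 : |u i * u j / r ^ 2| ≤ 1 := by
    rw [abs_div, abs_mul, abs_of_pos (by positivity : 0 < r ^ 2), div_le_one (by positivity), sq]
    gcongr
  have h2 : |(if i = j then (1 : ℝ) else 0)| ≤ 1 := by split_ifs <;> simp
  rw [abs_mul, abs_of_pos (inv_pos.mpr hr0), mul_comm]
  gcongr
  exact (abs_sub _ _).trans (by linarith)

lemma le_rn (e : ℝ) (u : EuclideanSpace ℝ (Fin 3)) : ‖u‖ ≤ rn e u := by
  unfold rn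
  exact Real.le_sqrt_of_sq_le (by nlinarith [sq_nonneg e])

lemma rn_zero (u : EuclideanSpace ℝ (Fin 3)) : rn 0 u = ‖u‖ := by
  simp [rn]

lemma continuous_rn (u : EuclideanSpace ℝ (Fin 3)) : Continuous fun e => rn e u := by
  unfold rn; fun_prop

lemma integrable_inv_mul {b : EuclideanSpace ℝ (Fin 3) → ℝ}
    (hb : Continuous b) (hs : HasCompactSupport b) :
    Integrable (fun u => 2 * ‖u‖⁻¹ * |b u|) := by
  have hl : LocallyIntegrable (fun u : EuclideanSpace ℝ (Fin 3) => 2 * ‖u‖⁻¹) volume := by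
    refine locallyIntegrable_of_norm_le_rpow (C := 2) (α := 1) (by simp) (by simp)
      (Filter.Eventually.of_forall fun u => ?_)
      (Measurable.aestronglyMeasurable (by fun_prop))
    simp [Real.rpow_neg_one]
  exact hl.integrable_smul_right_of_hasCompactSupport hb.abs hs.norm

lemma measurable_ker (i j : Fin 3) : Measurable fun u => landauKernel u i j := by
  unfold landauKernel
  fun_prop

lemma integrable_ker {b : EuclideanSpace ℝ (Fin 3) → ℝ}
    (hb : Continuous b) (hs : HasCompactSupport b) (i j : Fin 3) :
    Integrable (fun u => landauKernel u i j * b u) := by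
  refine (integrable_inv_mul hb hs).mono'
    ((measurable_ker i j).mul hb.measurable).aestronglyMeasurable ?_
  refine Filter.Eventually.of_forall fun u => ?_
  rw [norm_mul]
  rcases eq_or_ne u 0 with rfl | hu
  · simp [landauKernel]
  · exact mul_le_mul_of_nonneg_right (ker_bound u hu le_rfl i j) (abs_nonneg _)

open Filter Topology in
lemma key {b : EuclideanSpace ℝ (Fin 3) → ℝ}
    (hb : ContDiff ℝ (⊤ : ℕ∞) b) (hs : HasCompactSupport b) (i j : Fin 3) :
    ∫ u, landauKernel u i j * b u = ∫ u, ‖u‖ * pd i (pd j b) u := by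
  have t1 : Tendsto (fun e : ℝ => ∫ u, rn e u * pd i (pd j b) u) (𝓝[>] 0)
      (𝓝 (∫ u, ‖u‖ * pd i (pd j b) u)) := by
    have hc := (contDiff_pd i (contDiff_pd j hb)).continuous
    refine tendsto_integral_filter_of_dominated_convergence
      (fun u => rn 1 u * |pd i (pd j b) u|) ?_ ?_ ?_ ?_
    · filter_upwards [self_mem_nhdsWithin] with e he
      exact ((contDiff_rn he).continuous.mul hc).aestronglyMeasurable
    · filter_upwards [Ioo_mem_nhdsGT one_pos] with e he
      refine Eventually.of_forall fun u => ?_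
      rw [norm_mul, Real.norm_of_nonneg (rn_pos he.1 u).le]
      refine mul_le_mul_of_nonneg_right ?_ (abs_nonneg _)
      unfold rn
      refine Real.sqrt_le_sqrt ?_
      nlinarith [he.1, he.2]
    · exact integrable_cc (contDiff_rn one_pos).continuous hc.abs
        (hasCompactSupport_pd i (hasCompactSupport_pd j hs)).norm
    · refine Eventually.of_forall fun u => ?_
      have := (continuous_rn u).tendsto 0
      rw [rn_zero] at this
      exact (this.mono_left nhdsWithin_le_nhds).mul_const _
  have t2 : Tendsto (fun e : ℝ => ∫ u, ((rn e u)⁻¹ *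
      ((if i = j then (1 : ℝ) else 0) - u i * u j / rn e u ^ 2)) * b u) (𝓝[>] 0)
      (𝓝 (∫ u, landauKernel u i j * b u)) := by
    refine tendsto_integral_filter_of_dominated_convergence
      (fun u => 2 * ‖u‖⁻¹ * |b u|) ?_ ?_ (integrable_inv_mul hb.continuous hs) ?_
    · filter_upwards [self_mem_nhdsWithin] with e he
      have h1 := (contDiff_rn he).continuous.measurable
      have h2 := hb.continuous.measurable
      exact Measurable.aestronglyMeasurable (by fun_prop)
    · filter_upwards [self_mem_nhdsWithin] with e he
      filter_upwards [Measure.ae_ne volume (0 : EuclideanSpace ℝ (Fin 3))] with u hu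
      rw [norm_mul]
      exact mul_le_mul_of_nonneg_right (ker_bound u hu (le_rn e u) i j) (abs_nonneg _)
    · filter_upwards [Measure.ae_ne volume (0 : EuclideanSpace ℝ (Fin 3))] with u hu
      have h := (continuous_rn u).tendsto 0
      rw [rn_zero] at h
      replace h := h.mono_left (nhdsWithin_le_nhds (s := Set.Ioi 0))
      have hu' : ‖u‖ ≠ 0 := norm_ne_zero_iff.mpr hu
      exact ((h.inv₀ hu').mul (tendsto_const_nhds.sub
        (tendsto_const_nhds.div (h.pow 2) (pow_ne_zero 2 hu')))).mul_const _
  refine tendsto_nhds_unique t2 (t1.congr' ?_)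
  filter_upwards [self_mem_nhdsWithin] with e he
  exact ibp_rn he hb hs i j

lemma pd_reflect (h : EuclideanSpace ℝ (Fin 3) → ℝ) (hd : Differentiable ℝ h)
    (v : EuclideanSpace ℝ (Fin 3)) (i : Fin 3) :
    pd i (fun u => h (v - u)) = fun u => - pd i h (v - u) := by
  ext u
  have h1 : HasFDerivAt (fun u : EuclideanSpace ℝ (Fin 3) => v - u)
      (-ContinuousLinearMap.id ℝ _) u := (hasFDerivAt_id u).const_sub v
  have h2 := (hd (v - u)).hasFDerivAt.comp u h1
  have h3 : fderiv ℝ (fun u => h (v - u)) u = _ := h2.fderiv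
  rw [pd, h3]
  simp [pd]

lemma pd_neg' (h : EuclideanSpace ℝ (Fin 3) → ℝ) (i : Fin 3) :
    pd i (fun u => - h u) = fun u => - pd i h u := by
  ext u
  simp [pd, fderiv_fun_neg]

/-- For `f` smooth with compact support, the convolution of the
Landau kernel with `∇f` equals the gradient of the Laplacian of the Rosenbluth
potential: `∫ Σ_j A_{ij}(v−w) ∂_j f(w) dw = ∂_i(Δ(ψ⋆f))(v)`. -/
theorem conv_landauKernel_grad_eq_grad_laplacian_rosenbluth
    (f : EuclideanSpace ℝ (Fin 3) → ℝ)
    (hf : ContDiff ℝ (⊤ : ℕ∞) f) (hsupp : HasCompactSupport f)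
    (v : EuclideanSpace ℝ (Fin 3)) (i : Fin 3) :
    ∫ w, ∑ j, landauKernel (v - w) i j * pd j f w
      = pd i (lap (fun x => ∫ u, ‖u‖ * f (x - u))) v := by
  rw [grad_lap_conv hf hsupp]
  have hc := fun j => contDiff_pd j hf
  have hr : ∀ j, ContDiff ℝ (⊤ : ℕ∞) (fun u => pd j f (v - u)) := fun j =>
    (hc j).comp (contDiff_const.sub contDiff_id)
  have hrs : ∀ j, HasCompactSupport (fun u => pd j f (v - u)) := fun j =>
    (hasCompactSupport_pd j hsupp).comp_homeomorph (Homeomorph.subLeft v)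
  have e1 := integral_sub_left_eq_self
    (fun u => ∑ j, landauKernel u i j * pd j f (v - u)) volume v
  simp only [sub_sub_cancel] at e1
  rw [e1, integral_finsetSum _ fun j _ => integrable_ker (hr j).continuous (hrs j) i j]
  refine Finset.sum_congr rfl fun j _ => ?_
  rw [key (hr j) (hrs j) i j, pd_reflect _ ((hc j).differentiable (by simp)), pd_neg',
    pd_reflect _ ((contDiff_pd j (hc j)).differentiable (by simp))]
  simp
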